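/- arXiv:2604.09135 — 2 statements merged into one kernel-verified Lean document; each statement's English description precedes it below -/
import Mathlib

section
/- Let 1 ≤ k ≤ d be natural numbers. Let p : ℝ^d → ℝ be a measurable probability density with respect to Lebesgue measure (p ≥ 0 and ∫_{ℝ^d} p = 1) such that the Fourier transform of p has no zeros, i.e. for all t ∈ ℝ^d, (2π)^{-d/2} ∫_{ℝ^d} p(e) exp(−i⟨t,e⟩) de ≠ 0. Let A : ℝ^k → ℝ^d be an injective linear map. Let δ : ℝ^k → ℝ be measurable and essentially bounded with respect to Lebesgue measure. If for Lebesgue-almost every w ∈ ℝ^d the function u ↦ p(w − A u) δ(u) is Lebesgue integrable on ℝ^k and ∫_{ℝ^k} p(w − A u) δ(u) du = 0, then δ = 0 Lebesgue-almost everywhere on ℝ^k. (In other words, under the SPICE assumption the error mechanism u ↦ p(w − A u) is L∞-complete.) -/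
open MeasureTheory Complex
open scoped RealInnerProductSpace

section WienerTauberian

open Filter Topology Convolution FourierTransform SchwartzMap ENNReal ContinuousLinearMap

variable {E : Type*} [NormedAddCommGroup E] [InnerProductSpace ℝ E]

/-- The function `x ↦ r ^ n e^{2πi⟨x, t₀⟩} W (r x)`, whose Fourier transform is that of `W`
dilated by `r` and centred at `t₀`. -/
noncomputable def modDilate (t₀ : E) (r : ℝ) (W : E → ℂ) (x : E) : ℂ :=
  (𝐞 ⟪x, t₀⟫ : ℂ) * ((r ^ Module.finrank ℝ E : ℝ) * W (r • x))

theorem continuous_modDilate (t₀ : E) (r : ℝ) {W : E → ℂ} (hW : Continuous W) :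
    Continuous (modDilate t₀ r W) := by
  unfold modDilate
  have : Continuous fun x : E ↦ (𝐞 ⟪x, t₀⟫ : ℂ) := by
    exact continuous_subtype_val.comp (Real.continuous_fourierChar.comp (by fun_prop))
  fun_prop

theorem exists_norm_schwartz_le (φ : 𝓢(E, ℂ)) : ∃ C, ∀ x, ‖φ x‖ ≤ C := by
  obtain ⟨C, hC⟩ := φ.decay 0 0
  exact ⟨C, fun x ↦ by simpa using hC.2 x⟩

theorem exists_linearEquiv_prod_extending {F : Type*} [AddCommGroup F] [Module ℝ F]
    (A : F →ₗ[ℝ] E) (hA : Function.Injective A) :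
    ∃ (q : Submodule ℝ E) (Φ : (F × q) ≃ₗ[ℝ] E), ∀ u y, Φ (u, y) = A u + y := by
  obtain ⟨q, hq⟩ := (LinearMap.range A).exists_isCompl
  exact ⟨q, ((LinearEquiv.ofInjective A hA).prodCongr (LinearEquiv.refl ℝ q)).trans
    (Submodule.prodEquivOfIsCompl _ q hq), fun u y ↦ by simp⟩

variable [FiniteDimensional ℝ E]

theorem exists_schwartz_eq_one_closedBall (t₀ : E) {r : ℝ} (hr : 0 < r) :
    ∃ η : 𝓢(E, ℂ), (∀ t ∈ Metric.closedBall t₀ r, η t = 1) ∧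
      ∀ t ∉ Metric.closedBall t₀ (2 * r), η t = 0 := by
  let f : ContDiffBump t₀ := ⟨r, 2 * r, hr, by linarith⟩
  have hcs : HasCompactSupport fun t ↦ (f t : ℂ) :=
    f.hasCompactSupport.comp_left (g := Complex.ofReal) Complex.ofReal_zero
  refine ⟨hcs.toSchwartzMap (Complex.ofRealCLM.contDiff.comp f.contDiff), fun t ht ↦ ?_,
    fun t ht ↦ ?_⟩
  · change ((f t : ℝ) : ℂ) = 1
    rw [f.one_of_mem_closedBall ht, Complex.ofReal_one]
  · change ((f t : ℝ) : ℂ) = 0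
    rw [f.zero_of_le_dist (le_of_lt (by simpa using ht)), Complex.ofReal_zero]

variable [MeasurableSpace E] [BorelSpace E]

theorem tendsto_lintegral_enorm_sub_translate {f : E → ℂ} (hf : Integrable f) :
    Tendsto (fun z : E ↦ ∫⁻ x, ‖f x - f (x - z)‖ₑ) (𝓝 0) (𝓝 0) := by
  let T : C(E, C(E, E)) :=
    (ContinuousMap.mk (fun a : E × E ↦ a.2 - a.1) (by fun_prop)).curry
  have hT : ∀ z, MeasurePreserving (T z) (volume : Measure E) volume := fun z ↦
    measurePreserving_sub_right volume z
  have hf1 : MemLp f 1 := memLp_one_iff_integrable.2 hf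
  have hc : Continuous fun z ↦ Lp.compMeasurePreserving (T z) (hT z) (hf1.toLp f) :=
    continuous_const.compMeasurePreservingLp T.continuous hT one_ne_top
  have h2 := (continuous_const.edist hc : Continuous fun z ↦
    edist (hf1.toLp f) (Lp.compMeasurePreserving (T z) (hT z) (hf1.toLp f)))
  have key : ∀ z, edist (hf1.toLp f) (Lp.compMeasurePreserving (T z) (hT z) (hf1.toLp f))
      = ∫⁻ x, ‖f x - f (x - z)‖ₑ := by
    intro z
    rw [Lp.toLp_compMeasurePreserving, Lp.edist_toLp_toLp, eLpNorm_one_eq_lintegral_enorm]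
    rfl
  simp_rw [key] at h2
  simpa using h2.tendsto 0

theorem tendsto_lintegral_enorm_mul_translate {f g : E → ℂ} (hf : Integrable f)
    (hg : Integrable g) (hgc : Continuous g) :
    Tendsto (fun s : ℝ ↦ ∫⁻ y, ‖f y‖ₑ * ∫⁻ x, ‖g x - g (x - s • y)‖ₑ) (𝓝 0) (𝓝 0) := by
  have hb : ∀ z, ∫⁻ x, ‖g x - g (x - z)‖ₑ ≤ 2 * ∫⁻ x, ‖g x‖ₑ := by
    intro z
    calc ∫⁻ x, ‖g x - g (x - z)‖ₑ ≤ ∫⁻ x, (‖g x‖ₑ + ‖g (x - z)‖ₑ) :=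
          lintegral_mono fun x ↦ enorm_sub_le
      _ = 2 * ∫⁻ x, ‖g x‖ₑ := by
          rw [lintegral_add_left hgc.measurable.enorm,
            lintegral_sub_right_eq_self (fun x ↦ ‖g x‖ₑ) z, two_mul]
  have hmeas : ∀ s : ℝ, Measurable fun y : E ↦ ∫⁻ x, ‖g x - g (x - s • y)‖ₑ := by
    intro s
    refine Measurable.lintegral_prod_right' (f := fun q : E × E ↦ ‖g q.2 - g (q.2 - s • q.1)‖ₑ) ?_
    have : Continuous fun q : E × E ↦ g q.2 - g (q.2 - s • q.1) := by fun_prop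
    exact this.measurable.enorm
  have hfin : ∫⁻ y, ‖f y‖ₑ * (2 * ∫⁻ x, ‖g x‖ₑ) ≠ ∞ := by
    rw [lintegral_mul_const' _ _ (mul_ne_top ofNat_ne_top hg.2.ne)]
    exact mul_ne_top hf.2.ne (mul_ne_top ofNat_ne_top hg.2.ne)
  have := tendsto_lintegral_filter_of_dominated_convergence' (l := 𝓝 (0 : ℝ)) (f := fun _ ↦ 0)
    (F := fun (s : ℝ) (y : E) ↦ ‖f y‖ₑ * ∫⁻ x, ‖g x - g (x - s • y)‖ₑ)
    (μ := (volume : Measure E)) (fun y ↦ ‖f y‖ₑ * (2 * ∫⁻ x, ‖g x‖ₑ))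
    (Eventually.of_forall fun s ↦ hf.1.enorm.mul (hmeas s).aemeasurable)
    (Eventually.of_forall fun s ↦ Eventually.of_forall fun y ↦ by
      gcongr; exact hb _) hfin ?_
  · simpa using this
  · refine Eventually.of_forall fun y ↦ ?_
    have h1 : Tendsto (fun s : ℝ ↦ s • y) (𝓝 0) (𝓝 0) := by
      have : Continuous fun s : ℝ ↦ s • y := by fun_prop
      simpa using this.tendsto 0
    have h2 := (tendsto_lintegral_enorm_sub_translate hg).comp h1
    simpa using ENNReal.Tendsto.const_mul h2 (Or.inr (enorm_ne_top (x := f y)))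

theorem lintegral_comp_smul_addHaar (g : E → ℝ≥0∞) (hg : Measurable g) {r : ℝ} (hr : 0 < r) :
    ENNReal.ofReal (r ^ Module.finrank ℝ E) * ∫⁻ x, g (r • x) = ∫⁻ x, g x := by
  have h := lintegral_map (μ := (volume : Measure E)) hg (measurable_const_smul r)
  rw [← h, Measure.map_addHaar_smul _ hr.ne', lintegral_smul_measure, smul_eq_mul, ← mul_assoc,
    ← ENNReal.ofReal_mul (by positivity), abs_of_pos (by positivity),
    mul_inv_cancel₀ (by positivity), ENNReal.ofReal_one, one_mul]

theorem integral_comp_smul_addHaar (g : E → ℂ) {r : ℝ} (hr : 0 < r) :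
    ((r ^ Module.finrank ℝ E : ℝ) : ℂ) * ∫ x, g (r • x) = ∫ x, g x := by
  rw [Measure.integral_comp_smul_of_nonneg volume g r (hR := hr.le), Complex.real_smul,
    ← mul_assoc, ← Complex.ofReal_mul, mul_inv_cancel₀ (by positivity), Complex.ofReal_one, one_mul]

theorem integrable_modDilate (t₀ : E) {r : ℝ} (hr : 0 < r) {W : E → ℂ} (hW : Continuous W)
    (hWi : Integrable W) : Integrable (modDilate t₀ r W) := by
  have h1 : Integrable fun x ↦ ((r ^ Module.finrank ℝ E : ℝ) : ℂ) * W (r • x) :=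
    (hWi.comp_smul hr.ne').const_mul _
  refine h1.mono (continuous_modDilate t₀ r hW).aestronglyMeasurable (Eventually.of_forall ?_)
  intro x
  simp [modDilate, Circle.norm_coe]

theorem fourier_modDilate (t₀ : E) {r : ℝ} (hr : 0 < r) (W : E → ℂ) (t : E) :
    𝓕 (modDilate t₀ r W) t = 𝓕 W (r⁻¹ • (t - t₀)) := by
  rw [Real.fourier_eq, Real.fourier_eq]
  have : ∀ x, 𝐞 (-⟪x, t⟫) • modDilate t₀ r W x = ((r ^ Module.finrank ℝ E : ℝ) : ℂ) *
      (fun y ↦ 𝐞 (-⟪y, r⁻¹ • (t - t₀)⟫) • W y) (r • x) := by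
    intro x
    have h1 : -⟪r • x, r⁻¹ • (t - t₀)⟫ = -⟪x, t⟫ + ⟪x, t₀⟫ := by
      rw [real_inner_smul_left, real_inner_smul_right, inner_sub_right]
      field_simp
      ring
    simp only [modDilate, Circle.smul_def, smul_eq_mul]
    rw [h1, AddChar.map_add_eq_mul, Circle.coe_mul]
    ring
  rw [integral_congr_ae (Eventually.of_forall this), integral_const_mul]
  exact integral_comp_smul_addHaar (fun y ↦ 𝐞 (-⟪y, r⁻¹ • (t - t₀)⟫) • W y) hr

theorem convolutionExists_of_integrable_of_bounded {f g : E → ℂ} (hf : Integrable f)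
    (hg : AEStronglyMeasurable g) {C : ℝ} (hC : ∀ x, ‖g x‖ ≤ C) :
    ConvolutionExists f g (mul ℂ ℂ) volume := by
  intro x
  refine BddAbove.convolutionExistsAt _ (s := Set.univ) ?_ MeasurableSet.univ (Set.subset_univ _)
    hf.integrableOn (by simpa using hg)
  exact ⟨C, by rintro _ ⟨y, -, rfl⟩; exact hC y⟩

theorem norm_convolution_le_of_bounded {f g : E → ℂ} (hf : Integrable f) {C : ℝ}
    (hC : ∀ x, ‖g x‖ ≤ C) (x : E) : ‖(f ⋆[mul ℂ ℂ] g) x‖ ≤ (∫ y, ‖f y‖) * C := by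
  rw [convolution_def, ← integral_mul_const]
  refine norm_integral_le_of_norm_le (hf.norm.mul_const C) (Eventually.of_forall fun y ↦ ?_)
  simp only [mul_apply', norm_mul]
  gcongr
  exact hC _

theorem aestronglyMeasurable_convolution {f g : E → ℂ} (hf : AEStronglyMeasurable f)
    (hg : AEStronglyMeasurable g) : AEStronglyMeasurable (f ⋆[mul ℂ ℂ] g) :=
  (hf.convolution_integrand (mul ℂ ℂ) hg).integral_prod_right'

theorem convolution_assoc_of_bounded {f g k : E → ℂ} (hf : Integrable f) (hg : Integrable g)
    (hk : AEStronglyMeasurable k) {C : ℝ} (hC : ∀ x, ‖k x‖ ≤ C) :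
    (f ⋆[mul ℂ ℂ] g) ⋆[mul ℂ ℂ] k = f ⋆[mul ℂ ℂ] (g ⋆[mul ℂ ℂ] k) := by
  have hbdd : ∀ {u v : E → ℝ}, Integrable u → AEStronglyMeasurable v → ∀ {D : ℝ},
      (∀ x, ‖v x‖ ≤ D) → ∀ x, ConvolutionExistsAt u v x (mul ℝ ℝ) volume := by
    intro u v hu hv D hD x
    refine BddAbove.convolutionExistsAt _ (s := Set.univ) ?_ MeasurableSet.univ
      (Set.subset_univ _) hu.integrableOn (by simpa using hv)
    exact ⟨D, by rintro _ ⟨y, -, rfl⟩; exact hD y⟩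
  ext x
  refine convolution_assoc _ _ _ _ (fun a b c ↦ by simp [mul_assoc]) hf.1 hg.1 hk
    (hf.ae_convolution_exists _ hg)
    (Eventually.of_forall (hbdd hg.norm hk.norm (D := C) (by simpa using hC)))
    (hbdd hf.norm (D := (∫ y, ‖g y‖) * C) ?_ (fun z ↦ ?_) x)
  · exact (hg.1.norm.convolution_integrand (mul ℝ ℝ) hk.norm).integral_prod_right'
  · rw [convolution_def, ← integral_mul_const]
    refine norm_integral_le_of_norm_le (hg.norm.mul_const C) (Eventually.of_forall fun y ↦ ?_)
    simp only [mul_apply', norm_mul, norm_norm]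
    gcongr
    exact hC _

theorem convolution_mul_comm (f g : E → ℂ) : f ⋆[mul ℂ ℂ] g = g ⋆[mul ℂ ℂ] f := by
  rw [← MeasureTheory.convolution_flip, flip_mul]

theorem lintegral_fourier_mul_modDilate_sub_convolution_le {p W : E → ℂ} (hp : Integrable p)
    (hWc : Continuous W) {C : ℝ} (hC : ∀ x, ‖W x‖ ≤ C) (t₀ : E) {r : ℝ}
    (hr : 0 < r) :
    ∫⁻ x, ‖𝓕 p t₀ * modDilate t₀ r W x - (p ⋆[mul ℂ ℂ] modDilate t₀ r W) x‖ₑ ≤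
      ∫⁻ y, ‖p y‖ₑ * ∫⁻ x, ‖W x - W (x - r • y)‖ₑ := by
  have hVb : ∀ x, ‖modDilate t₀ r W x‖ ≤ r ^ Module.finrank ℝ E * C := by
    intro x
    simp only [modDilate, norm_mul, Circle.norm_coe, one_mul, Complex.norm_real]
    rw [Real.norm_of_nonneg (by positivity)]
    gcongr
    exact hC _
  have hVc := continuous_modDilate t₀ r hWc
  have hpt : ∀ x, ‖𝓕 p t₀ * modDilate t₀ r W x - (p ⋆[mul ℂ ℂ] modDilate t₀ r W) x‖ₑ ≤
      ∫⁻ y, ‖p y‖ₑ * (ENNReal.ofReal (r ^ Module.finrank ℝ E) *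
        ‖W (r • x) - W (r • x - r • y)‖ₑ) := by
    intro x
    rw [Real.fourier_eq, convolution_def, ← integral_mul_const, ← integral_sub]
    · refine (enorm_integral_le_lintegral_enorm _).trans_eq (lintegral_congr fun y ↦ ?_)
      have : 𝐞 (-⟪y, t₀⟫) • p y * modDilate t₀ r W x - mul ℂ ℂ (p y) (modDilate t₀ r W (x - y))
          = p y * ((𝐞 (⟪x, t₀⟫ + -⟪y, t₀⟫) : ℂ) * ((r ^ Module.finrank ℝ E : ℝ) *
            (W (r • x) - W (r • x - r • y)))) := by
        simp only [modDilate, mul_apply', smul_sub, inner_sub_left, Circle.smul_def, smul_eq_mul]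
        rw [sub_eq_add_neg ⟪x, t₀⟫, AddChar.map_add_eq_mul, Circle.coe_mul]
        ring
      rw [this, enorm_mul, enorm_mul, enorm_mul]
      congr 1
      rw [← ofReal_norm (E := ℂ) (𝐞 _ : ℂ), Circle.norm_coe, ENNReal.ofReal_one, one_mul,
        ← ofReal_norm (E := ℂ) (ofReal _), Complex.norm_real, Real.norm_of_nonneg (by positivity)]
    · exact ((Real.fourierIntegral_convergent_iff t₀).2 hp).mul_const _
    · exact convolutionExists_of_integrable_of_bounded hp hVc.aestronglyMeasurable hVb x
  calc _ ≤ ∫⁻ x, ∫⁻ y, ‖p y‖ₑ * (ENNReal.ofReal (r ^ Module.finrank ℝ E) *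
        ‖W (r • x) - W (r • x - r • y)‖ₑ) := lintegral_mono hpt
    _ = ∫⁻ y, ∫⁻ x, ‖p y‖ₑ * (ENNReal.ofReal (r ^ Module.finrank ℝ E) *
        ‖W (r • x) - W (r • x - r • y)‖ₑ) := by
      refine lintegral_lintegral_swap (AEMeasurable.mul hp.1.enorm.comp_snd ?_)
      have : Continuous fun q : E × E ↦ W (r • q.1) - W (r • q.1 - r • q.2) := by fun_prop
      exact (this.measurable.enorm.const_mul _).aemeasurable
    _ = _ := by
      refine lintegral_congr fun y ↦ ?_
      have hm : Measurable fun x ↦ ‖W x - W (x - r • y)‖ₑ := by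
        have : Continuous fun x ↦ W x - W (x - r • y) := by fun_prop
        exact this.measurable.enorm
      have hm' : Measurable fun x ↦ ‖W (r • x) - W (r • x - r • y)‖ₑ :=
        hm.comp (measurable_const_smul r)
      rw [lintegral_const_mul _ (hm'.const_mul _), lintegral_const_mul _ hm',
        lintegral_comp_smul_addHaar (fun x ↦ ‖W x - W (x - r • y)‖ₑ) hm hr]

theorem lintegral_sub_modDilate_convolution_le {φ W : E → ℂ} (hWi : Integrable W)
    (hW : ∫ x, W x = 1) (hφc : Continuous φ) {C : ℝ} (hC : ∀ x, ‖φ x‖ ≤ C) {r : ℝ}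
    (hr : 0 < r) :
    ∫⁻ x, ‖φ x - (modDilate 0 r W ⋆[mul ℂ ℂ] φ) x‖ₑ ≤
      ∫⁻ y, ‖W y‖ₑ * ∫⁻ x, ‖φ x - φ (x - r⁻¹ • y)‖ₑ := by
  have hpt : ∀ x, ‖φ x - (modDilate 0 r W ⋆[mul ℂ ℂ] φ) x‖ₑ ≤
      ∫⁻ y, ‖W y‖ₑ * ‖φ x - φ (x - r⁻¹ • y)‖ₑ := by
    intro x
    have h1 : (modDilate 0 r W ⋆[mul ℂ ℂ] φ) x = ∫ y, W y * φ (x - r⁻¹ • y) := by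
      have : ∀ y, mul ℂ ℂ (modDilate 0 r W y) (φ (x - y)) = (r ^ Module.finrank ℝ E : ℝ) *
          (fun z ↦ W z * φ (x - r⁻¹ • z)) (r • y) := by
        intro y
        simp [modDilate, smul_smul, inv_mul_cancel₀ hr.ne', mul_assoc]
      rw [convolution_def, integral_congr_ae (Eventually.of_forall this), integral_const_mul]
      exact integral_comp_smul_addHaar (fun z ↦ W z * φ (x - r⁻¹ • z)) hr
    have h2 : φ x = ∫ y, W y * φ x := by rw [integral_mul_const, hW, one_mul]
    rw [h1, h2, ← integral_sub (hWi.mul_const _), ← h2]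
    · refine (enorm_integral_le_lintegral_enorm _).trans_eq (lintegral_congr fun y ↦ ?_)
      rw [← mul_sub, enorm_mul]
    · refine hWi.mul_bdd (c := C) ?_ (Eventually.of_forall fun y ↦ hC _)
      have : Continuous fun y ↦ φ (x - r⁻¹ • y) := by fun_prop
      exact this.aestronglyMeasurable
  refine (lintegral_mono hpt).trans_eq ?_
  have hc : Continuous fun q : E × E ↦ φ q.1 - φ (q.1 - r⁻¹ • q.2) := by fun_prop
  have hm : AEMeasurable (Function.uncurry fun x y ↦ ‖W y‖ₑ * ‖φ x - φ (x - r⁻¹ • y)‖ₑ)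
      ((volume : Measure E).prod volume) :=
    hWi.1.enorm.comp_snd.mul hc.measurable.enorm.aemeasurable
  rw [lintegral_lintegral_swap hm]
  refine lintegral_congr fun y ↦ ?_
  rw [lintegral_const_mul]
  have : Continuous fun x ↦ φ x - φ (x - r⁻¹ • y) := by fun_prop
  exact this.measurable.enorm

theorem convolution_eq_schwartz_of_fourier_eq {V : E → ℂ} (hV : Integrable V) (φ k : 𝓢(E, ℂ))
    (h : ∀ t, 𝓕 V t * 𝓕 φ t = 𝓕 k t) : V ⋆[mul ℂ ℂ] φ = k := by
  obtain ⟨C, hC⟩ := exists_norm_schwartz_le φ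
  have hc : Continuous (V ⋆[mul ℂ ℂ] φ) :=
    BddAbove.continuous_convolution_right_of_integrable _
      ⟨C, by rintro _ ⟨x, rfl⟩; exact hC x⟩ hV φ.continuous
  have hi : Integrable (V ⋆[mul ℂ ℂ] φ) := hV.integrable_convolution _ φ.integrable
  have hF : 𝓕 (V ⋆[mul ℂ ℂ] φ) = 𝓕 (k : E → ℂ) := by
    ext t
    rw [Real.fourier_mul_convolution_eq hV φ.integrable, ← SchwartzMap.fourier_coe,
      ← SchwartzMap.fourier_coe, h]
  have hik : Integrable (𝓕 (k : E → ℂ)) := by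
    rw [← SchwartzMap.fourier_coe]; exact SchwartzMap.integrable _
  rw [← hc.fourierInv_fourier_eq hi (hF ▸ hik), hF, k.continuous.fourierInv_fourier_eq
    k.integrable hik]

theorem exists_convolution_eq_zero_of_fourier_support {p Δ : E → ℂ} (hp : Integrable p)
    (hΔ : AEStronglyMeasurable Δ) {C : ℝ} (hC : ∀ x, ‖Δ x‖ ≤ C)
    (h0 : p ⋆[mul ℂ ℂ] Δ =ᵐ[volume] 0) (t₀ : E) (ht₀ : 𝓕 p t₀ ≠ 0) :
    ∃ r > 0, ∀ h : 𝓢(E, ℂ), (∀ t ∉ Metric.closedBall t₀ r, 𝓕 h t = 0) →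
      (h : E → ℂ) ⋆[mul ℂ ℂ] Δ = 0 := by
  obtain ⟨η, hη, -⟩ := exists_schwartz_eq_one_closedBall (0 : E) one_pos
  let W : 𝓢(E, ℂ) := 𝓕⁻ η
  have hWη : 𝓕 (W : E → ℂ) = η := by
    rw [← SchwartzMap.fourier_coe, FourierTransform.fourier_fourierInv_eq]
  obtain ⟨CW, hCW⟩ := exists_norm_schwartz_le W
  have hsmall := (tendsto_lintegral_enorm_mul_translate hp W.integrable W.continuous).eventually
    (gt_mem_nhds (enorm_pos.2 ht₀))
  obtain ⟨r, hrs, hr⟩ := ((hsmall.filter_mono nhdsWithin_le_nhds).and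
    (self_mem_nhdsWithin (s := Set.Ioi (0 : ℝ)))).exists
  refine ⟨r, hr, fun h hh ↦ ?_⟩
  set V := modDilate t₀ r W with hVdef
  have hV : Integrable V := integrable_modDilate t₀ hr W.continuous W.integrable
  have hVh : V ⋆[mul ℂ ℂ] h = h := by
    refine convolution_eq_schwartz_of_fourier_eq hV h h fun t ↦ ?_
    by_cases ht : t ∈ Metric.closedBall t₀ r
    · rw [hVdef, fourier_modDilate t₀ hr, hWη, hη, one_mul]
      rw [mem_closedBall_iff_norm] at ht
      rw [mem_closedBall_zero_iff, norm_smul, norm_inv, Real.norm_of_nonneg hr.le]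
      rwa [inv_mul_le_iff₀ hr, mul_one]
    · rw [hh t ht, mul_zero]
  set F := (h : E → ℂ) ⋆[mul ℂ ℂ] Δ with hF
  have hFm : AEStronglyMeasurable F :=
    aestronglyMeasurable_convolution h.continuous.aestronglyMeasurable hΔ
  have hFb : ∀ x, ‖F x‖ ≤ (∫ y, ‖h y‖) * C := norm_convolution_le_of_bounded h.integrable hC
  have hVF : V ⋆[mul ℂ ℂ] F = F := by
    rw [hF, ← convolution_assoc_of_bounded hV h.integrable hΔ hC, hVh]
  have hpF : p ⋆[mul ℂ ℂ] F = 0 := by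
    rw [hF, ← convolution_assoc_of_bounded hp h.integrable hΔ hC, convolution_mul_comm p,
      convolution_assoc_of_bounded h.integrable hp hΔ hC,
      convolution_congr _ (ae_eq_refl (h : E → ℂ)) h0, convolution_zero]
  set R : E → ℂ := fun x ↦ 𝓕 p t₀ * V x - (p ⋆[mul ℂ ℂ] V) x with hR
  have hpV : Integrable (p ⋆[mul ℂ ℂ] V) := hp.integrable_convolution _ hV
  have hRi : Integrable R := (hV.const_mul _).sub hpV
  have hRF : ∀ x, (R ⋆[mul ℂ ℂ] F) x = 𝓕 p t₀ * F x := by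
    intro x
    have e1 := convolutionExists_of_integrable_of_bounded hV hFm hFb x
    have e2 := convolutionExists_of_integrable_of_bounded hpV hFm hFb x
    have : (R ⋆[mul ℂ ℂ] F) x = 𝓕 p t₀ * (V ⋆[mul ℂ ℂ] F) x -
        ((p ⋆[mul ℂ ℂ] V) ⋆[mul ℂ ℂ] F) x := by
      simp only [convolution_def (f := R), convolution_def (f := V),
        convolution_def (f := p ⋆[mul ℂ ℂ] V)]
      rw [← integral_const_mul, ← integral_sub (e1.integrable.const_mul _) e2.integrable]
      congr with y
      simp [hR, mul_assoc]
    rw [this, convolution_assoc_of_bounded hp hV hFm hFb, hVF, hpF]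
    simp
  have hRs : ∫ y, ‖R y‖ < ‖𝓕 p t₀‖ := by
    have := (lintegral_fourier_mul_modDilate_sub_convolution_le hp W.continuous hCW t₀
      hr).trans_lt hrs
    rw [integral_norm_eq_lintegral_enorm hRi.1]
    exact (ENNReal.toReal_lt_of_lt_ofReal (by rwa [ofReal_norm]))
  have hbdd : BddAbove (Set.range fun x ↦ ‖F x‖) := ⟨_, by rintro _ ⟨x, rfl⟩; exact hFb x⟩
  set S := ⨆ x, ‖F x‖ with hS
  have hFS : ∀ x, ‖F x‖ ≤ S := le_ciSup hbdd
  have hS0 : 0 ≤ S := (norm_nonneg _).trans (hFS 0)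
  have h1 : ∀ x, ‖F x‖ ≤ (∫ y, ‖R y‖) / ‖𝓕 p t₀‖ * S := by
    intro x
    have := norm_convolution_le_of_bounded hRi hFS x
    rw [hRF, norm_mul] at this
    rw [div_mul_eq_mul_div, le_div_iff₀ (norm_pos_iff.2 ht₀)]
    linarith
  have h2 : S ≤ (∫ y, ‖R y‖) / ‖𝓕 p t₀‖ * S := ciSup_le h1
  have h3 : (∫ y, ‖R y‖) / ‖𝓕 p t₀‖ < 1 := (div_lt_one (norm_pos_iff.2 ht₀)).2 hRs
  have h4 : S = 0 := by nlinarith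
  ext x
  exact norm_le_zero_iff.1 ((hFS x).trans h4.le)

theorem exists_cutoff_convolution_eq_zero {p Δ : E → ℂ} (hp : Integrable p)
    (hpF : ∀ t, 𝓕 p t ≠ 0) (hΔ : AEStronglyMeasurable Δ) {C : ℝ} (hC : ∀ x, ‖Δ x‖ ≤ C)
    (h0 : p ⋆[mul ℂ ℂ] Δ =ᵐ[volume] 0) {K : Set E} (hK : IsCompact K) :
    ∃ χ : 𝓢(E, ℂ), (∀ t ∈ K, χ t = 1) ∧
      ∀ ψ : 𝓢(E, ℂ), (𝓕⁻ (pairing (mul ℂ ℂ) χ ψ) : 𝓢(E, ℂ)) ⋆[mul ℂ ℂ] Δ = 0 := by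
  have hadd : ∀ f g : 𝓢(E, ℂ), (f + g : 𝓢(E, ℂ)) ⋆[mul ℂ ℂ] Δ =
      (f : E → ℂ) ⋆[mul ℂ ℂ] Δ + (g : E → ℂ) ⋆[mul ℂ ℂ] Δ := fun f g ↦ by
    ext x
    exact (convolutionExists_of_integrable_of_bounded f.integrable hΔ hC x).add_distrib
      (convolutionExists_of_integrable_of_bounded g.integrable hΔ hC x)
  refine hK.induction_on ⟨0, by simp, fun ψ ↦ ?_⟩ ?_ ?_ ?_
  · simp only [map_zero, zero_apply, FourierTransform.fourierInv_zero]
    exact zero_convolution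
  · rintro s t hst ⟨χ, h1, h2⟩
    exact ⟨χ, fun x hx ↦ h1 x (hst hx), h2⟩
  · rintro s t ⟨χ₁, h1, h1'⟩ ⟨χ₂, h2, h2'⟩
    refine ⟨χ₁ + (χ₂ - pairing (mul ℂ ℂ) χ₂ χ₁), ?_, fun ψ ↦ ?_⟩
    · rintro x (hx | hx)
      · simp [h1 x hx]
      · simp [h2 x hx]
    · have : pairing (mul ℂ ℂ) (χ₁ + (χ₂ - pairing (mul ℂ ℂ) χ₂ χ₁)) ψ =
          pairing (mul ℂ ℂ) χ₁ ψ + pairing (mul ℂ ℂ) χ₂ (ψ - pairing (mul ℂ ℂ) χ₁ ψ) := by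
        ext x
        simp
        ring
      rw [this, FourierTransform.fourierInv_add, hadd, h1', h2', add_zero]
  · intro t₀ _
    obtain ⟨r, hr, h⟩ := exists_convolution_eq_zero_of_fourier_support hp hΔ hC h0 t₀ (hpF t₀)
    obtain ⟨χ, h1, h2⟩ := exists_schwartz_eq_one_closedBall t₀ (half_pos hr)
    refine ⟨_, mem_nhdsWithin_of_mem_nhds (Metric.closedBall_mem_nhds t₀ (half_pos hr)), χ, h1,
      fun ψ ↦ h _ fun t ht ↦ ?_⟩
    rw [FourierTransform.fourier_fourierInv_eq, pairing_apply_apply, h2 t, map_zero,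
      zero_apply]
    rwa [mul_div_cancel₀ r two_ne_zero]

/-- A form of Wiener's Tauberian theorem: convolution with an integrable function whose Fourier
transform has no zeros is injective on bounded functions. -/
theorem ae_eq_zero_of_convolution_ae_eq_zero {p Δ : E → ℂ} (hp : Integrable p)
    (hpF : ∀ t, 𝓕 p t ≠ 0) (hΔ : AEStronglyMeasurable Δ) {C : ℝ} (hC : ∀ x, ‖Δ x‖ ≤ C)
    (h0 : p ⋆[mul ℂ ℂ] Δ =ᵐ[volume] 0) : Δ =ᵐ[volume] 0 := by
  have hC0 : 0 ≤ C := (norm_nonneg _).trans (hC 0)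
  obtain ⟨η, hη, hη'⟩ := exists_schwartz_eq_one_closedBall (0 : E) one_pos
  let W : 𝓢(E, ℂ) := 𝓕⁻ η
  have hWη : 𝓕 (W : E → ℂ) = η := by
    rw [← SchwartzMap.fourier_coe, FourierTransform.fourier_fourierInv_eq]
  have hW1 : ∫ x, W x = 1 := by
    have := congrFun hWη 0
    rw [hη 0 (by simp), Real.fourier_eq] at this
    simpa using this
  have main : ∀ φ : 𝓢(E, ℂ), ∀ x, ((φ : E → ℂ) ⋆[mul ℂ ℂ] Δ) x = 0 := by
    intro φ x
    obtain ⟨Cφ, hCφ⟩ := exists_norm_schwartz_le φ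
    have hz : ∀ s : ℝ, 0 < s → (modDilate 0 s⁻¹ W ⋆[mul ℂ ℂ] φ) ⋆[mul ℂ ℂ] Δ = 0 := by
      intro s hs
      have hs' : (0 : ℝ) < s⁻¹ := inv_pos.2 hs
      obtain ⟨χ, h1, h2⟩ := exists_cutoff_convolution_eq_zero hp hpF hΔ hC h0
        (isCompact_closedBall (0 : E) (2 * s⁻¹))
      let ηs : 𝓢(E, ℂ) := compCLMOfContinuousLinearEquiv ℂ
        (ContinuousLinearEquiv.smulLeft (Units.mk0 s hs.ne')) η
      have hηs : ∀ t, ηs t = η (s • t) := fun t ↦ rfl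
      rw [convolution_eq_schwartz_of_fourier_eq
        (integrable_modDilate 0 hs' W.continuous W.integrable) φ
        (𝓕⁻ (pairing (mul ℂ ℂ) χ (pairing (mul ℂ ℂ) ηs (𝓕 φ)))) fun t ↦ ?_, h2]
      rw [fourier_modDilate 0 hs', hWη, FourierTransform.fourier_fourierInv_eq,
        pairing_apply_apply, pairing_apply_apply, hηs, inv_inv, sub_zero]
      by_cases ht : t ∈ Metric.closedBall 0 (2 * s⁻¹)
      · simp [h1 t ht]
      · rw [hη' (s • t)]
        · simp
        · simp only [mem_closedBall_zero_iff, not_le, norm_smul, Real.norm_of_nonneg hs.le] at ht ⊢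
          rw [← div_eq_mul_inv, div_lt_iff₀ hs] at ht
          linarith
    have hsm := (tendsto_lintegral_enorm_mul_translate W.integrable φ.integrable φ.continuous)
    have hbound : ∀ s : ℝ, 0 < s → ‖((φ : E → ℂ) ⋆[mul ℂ ℂ] Δ) x‖ₑ ≤
        (∫⁻ y, ‖W y‖ₑ * ∫⁻ x, ‖φ x - φ (x - s • y)‖ₑ) * ENNReal.ofReal C := by
      intro s hs
      have hs' : (0 : ℝ) < s⁻¹ := inv_pos.2 hs
      have hVi : Integrable (modDilate 0 s⁻¹ W ⋆[mul ℂ ℂ] φ) :=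
        (integrable_modDilate 0 hs' W.continuous W.integrable).integrable_convolution _ φ.integrable
      have hd : Integrable ((φ : E → ℂ) - modDilate 0 s⁻¹ W ⋆[mul ℂ ℂ] φ) := φ.integrable.sub hVi
      have e : ((φ : E → ℂ) ⋆[mul ℂ ℂ] Δ) x =
          (((φ : E → ℂ) - modDilate 0 s⁻¹ W ⋆[mul ℂ ℂ] φ) ⋆[mul ℂ ℂ] Δ) x := by
        have := (convolutionExists_of_integrable_of_bounded hd hΔ hC x).add_distrib
          (convolutionExists_of_integrable_of_bounded hVi hΔ hC x)
        rw [sub_add_cancel, hz s hs] at this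
        simpa using this
      have h1 := norm_convolution_le_of_bounded hd hC x
      rw [← e] at h1
      have h2 := lintegral_sub_modDilate_convolution_le W.integrable hW1 φ.continuous hCφ hs'
      rw [inv_inv] at h2
      refine le_trans ?_ (mul_le_mul_left h2 (ENNReal.ofReal C))
      rw [← ofReal_norm]
      refine (ENNReal.ofReal_le_ofReal h1).trans_eq ?_
      rw [ENNReal.ofReal_mul (integral_nonneg fun _ ↦ norm_nonneg _),
        ofReal_integral_norm_eq_lintegral_enorm hd]
      rfl
    have hlim : Tendsto (fun s : ℝ ↦ (∫⁻ y, ‖W y‖ₑ * ∫⁻ x, ‖φ x - φ (x - s • y)‖ₑ) *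
        ENNReal.ofReal C) (𝓝[>] 0) (𝓝 0) := by
      simpa using ENNReal.Tendsto.mul_const (hsm.mono_left nhdsWithin_le_nhds)
        (Or.inr (ENNReal.ofReal_ne_top (r := C)))
    exact enorm_eq_zero.1 (le_antisymm (ge_of_tendsto hlim
      (eventually_nhdsWithin_of_forall fun s hs ↦ hbound s hs)) zero_le)
  have hloc : LocallyIntegrable Δ := by
    refine (locallyIntegrable_const C).mono hΔ (Eventually.of_forall fun x ↦ ?_)
    rw [Real.norm_of_nonneg hC0]
    exact hC x
  refine ae_eq_zero_of_integral_contDiff_smul_eq_zero hloc fun g hg hgc ↦ ?_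
  have hcs : HasCompactSupport fun t ↦ (g (-t) : ℂ) :=
    (hgc.comp_homeomorph (Homeomorph.neg E)).comp_left (g := Complex.ofReal) Complex.ofReal_zero
  have hcd : ContDiff ℝ ((⊤ : ℕ∞) : WithTop ℕ∞) fun t ↦ (g (-t) : ℂ) :=
    Complex.ofRealCLM.contDiff.comp (hg.comp contDiff_neg)
  have := main (hcs.toSchwartzMap hcd) 0
  rw [convolution_def, ← integral_neg_eq_self] at this
  simpa using this

/-- Convolving an integrable function whose Fourier transform has no zeros with a bounded density
along the range of an injective linear map determines that density. -/
theorem ae_eq_zero_of_integral_sub_linearMap_mul_ae_eq_zero {F : Type*} [NormedAddCommGroup F]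
    [InnerProductSpace ℝ F] [FiniteDimensional ℝ F] [MeasurableSpace F] [BorelSpace F]
    (A : F →ₗ[ℝ] E) (hA : Function.Injective A) {p : E → ℂ} (hp : Integrable p)
    (hpF : ∀ t, 𝓕 p t ≠ 0) {δ : F → ℂ} (hδ : Measurable δ) {C : ℝ} (hC : ∀ u, ‖δ u‖ ≤ C)
    (h0 : ∀ᵐ w, ∫ u, p (w - A u) * δ u = 0) : δ =ᵐ[volume] 0 := by
  obtain ⟨q, Φ, hΦ⟩ := exists_linearEquiv_prod_extending A hA
  let Ψ : (F × q) ≃L[ℝ] E := Φ.toContinuousLinearEquiv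
  have hΨ : ∀ u y, Ψ (u, y) = A u + y := hΦ
  let e : (F × q) ≃ᵐ E := Ψ.toHomeomorph.toMeasurableEquiv
  let ν : Measure E := Measure.map e ((volume : Measure F).prod (volume : Measure q))
  have : ν.IsAddHaarMeasure := Ψ.isAddHaarMeasure_map _
  let L : E →ₗ[ℝ] F := LinearMap.fst ℝ F q ∘ₗ Φ.symm
  have hL : Function.Surjective L := fun u ↦ ⟨Φ (u, 0), by simp [L]⟩
  have hLΨ : ∀ z, L (Ψ z) = z.1 := fun z ↦
    congrArg Prod.fst (Φ.symm_apply_apply z)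
  have hLm : Measurable L := L.continuous_of_finiteDimensional.measurable
  have hΔ : AEStronglyMeasurable (δ ∘ L) (volume : Measure E) :=
    (hδ.comp hLm).aestronglyMeasurable
  suffices δ ∘ L =ᵐ[volume] 0 from
    (ae_comp_linearMap_mem_iff L (volume : Measure E) (volume : Measure F) hL
      (hδ (measurableSet_singleton 0))).1 this
  refine ae_eq_zero_of_convolution_ae_eq_zero hp hpF hΔ (fun x ↦ hC (L x)) ?_
  have hslice : ∀ᵐ w : E, ∀ᵐ y : q, ∫ u, p (w - y - A u) * δ u = 0 := by
    have hN := measurableSet_toMeasurable volume {w : E | ¬ ∫ u, p (w - A u) * δ u = 0}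
    have hgood : ∀ᵐ w, w ∈ (toMeasurable volume {w : E | ¬ ∫ u, p (w - A u) * δ u = 0})ᶜ :=
      compl_mem_ae_iff.2 ((measure_toMeasurable _).trans h0)
    filter_upwards [(ae_ae_add_linearMap_mem_iff (-q.subtype) volume volume hN.compl).2 hgood]
      with w hw
    filter_upwards [hw] with y hy
    by_contra h
    refine hy (subset_toMeasurable _ _ ?_)
    simpa [sub_eq_add_neg] using h
  filter_upwards [hslice] with w hw
  have hex := convolutionExists_of_integrable_of_bounded hp hΔ (fun x ↦ hC (L x)) w
  have hint : Integrable (fun v ↦ p (w - v) * δ (L v)) ν := by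
    rw [Measure.isAddLeftInvariant_eq_smul ν volume]
    exact hex.integrable_swap.smul_measure_nnreal
  have hint' := (integrable_map_equiv e _).1 hint
  have hconv : (p ⋆[mul ℂ ℂ] (δ ∘ L)) w = ∫ v, p (w - v) * δ (L v) := convolution_eq_swap _
  rw [hconv, Measure.isAddLeftInvariant_eq_smul volume ν, integral_smul_nnreal_measure,
    integral_map_equiv, ← Function.comp_def (fun v ↦ p (w - v) * δ (L v)) e,
    integral_prod_symm _ hint', integral_eq_zero_of_ae, smul_zero]
  · rfl
  filter_upwards [hw] with y hy
  rw [Pi.zero_apply, ← hy]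
  refine integral_congr_ae (Eventually.of_forall fun u ↦ ?_)
  change p (w - Ψ (u, y)) * δ (L (Ψ (u, y))) = _
  rw [hLΨ, hΨ, add_comm, ← sub_sub]

end WienerTauberian

/-- **SPICE L∞-completeness.** If `p` is a probability density on `ℝ^d` whose Fourier
transform has no zeros and `A : ℝ^k → ℝ^d` is an injective linear map (`1 ≤ k ≤ d`), then
the error mechanism `u ↦ p (w - A u)` is L∞-complete: any measurable essentially bounded
`δ` with `∫ p (w - A u) δ u du = 0` for almost every `w` vanishes almost everywhere. -/
theorem spice_Linfty_complete
    (k d : ℕ) (hk : 1 ≤ k) (hkd : k ≤ d)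
    (p : EuclideanSpace ℝ (Fin d) → ℝ)
    (hp_meas : Measurable p)
    (hp_nonneg : ∀ x, 0 ≤ p x)
    (hp_int : ∫ x, p x = 1)
    (hp_fourier : ∀ t : EuclideanSpace ℝ (Fin d),
      ((2 * Real.pi) ^ (-(d : ℝ) / 2) : ℝ) •
        ∫ e, (p e : ℂ) * Complex.exp (-Complex.I * (⟪t, e⟫ : ℝ)) ≠ 0)
    (A : EuclideanSpace ℝ (Fin k) →ₗ[ℝ] EuclideanSpace ℝ (Fin d))
    (hA : Function.Injective A)
    (δ : EuclideanSpace ℝ (Fin k) → ℝ)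
    (hδ_meas : Measurable δ)
    (hδ_bdd : ∃ C : ℝ, ∀ᵐ u : EuclideanSpace ℝ (Fin k), |δ u| ≤ C)
    (h0 : ∀ᵐ w : EuclideanSpace ℝ (Fin d),
      Integrable (fun u : EuclideanSpace ℝ (Fin k) => p (w - A u) * δ u) ∧
      ∫ u : EuclideanSpace ℝ (Fin k), p (w - A u) * δ u = 0) :
    δ =ᵐ[volume] 0 := by
  obtain ⟨C, hC⟩ := hδ_bdd
  have hp : Integrable p := by
    by_contra h
    rw [integral_undef h] at hp_int
    exact zero_ne_one hp_int
  have hpF : ∀ t, FourierTransform.fourier (fun x ↦ (p x : ℂ)) t ≠ 0 := by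
    intro t h
    apply hp_fourier ((2 * Real.pi) • t)
    rw [Real.fourier_eq'] at h
    convert smul_zero _ using 2
    rw [← h]
    refine integral_congr_ae (.of_forall fun e ↦ ?_)
    simp only [smul_eq_mul, real_inner_smul_left, real_inner_comm e t]
    rw [mul_comm]
    congr 2
    push_cast
    ring
  let δ' : EuclideanSpace ℝ (Fin k) → ℝ := fun u ↦ if |δ u| ≤ C then δ u else 0
  have hδ' : δ' =ᵐ[volume] δ := by
    filter_upwards [hC] with u hu using if_pos hu
  have hδ'm : Measurable δ' :=
    hδ_meas.ite (measurableSet_le hδ_meas.abs measurable_const) measurable_const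
  have hδ'b : ∀ u, ‖(δ' u : ℂ)‖ ≤ max C 0 := by
    intro u
    rw [norm_real, Real.norm_eq_abs]
    by_cases hu : |δ u| ≤ C <;> simp [δ', hu]
  have h0' : ∀ᵐ w, ∫ u, (p (w - A u) : ℂ) * (δ' u : ℂ) = 0 := by
    filter_upwards [h0] with w hw
    rw [← ofReal_zero, ← hw.2, ← integral_complex_ofReal]
    refine integral_congr_ae ?_
    filter_upwards [hδ'] with u hu
    rw [hu]
    push_cast
    rfl
  have key := ae_eq_zero_of_integral_sub_linearMap_mul_ae_eq_zero A hA hp.ofReal hpF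
    (measurable_ofReal.comp hδ'm) hδ'b h0'
  filter_upwards [key, hδ'] with u hu hu'
  rw [← hu']
  exact ofReal_eq_zero.1 hu
end

section
/- Let k ≥ 1 and let f : ℝ^k → ℝ be Lebesgue integrable with Fourier transform having no zeros, i.e. for all t ∈ ℝ^k, (2π)^{-k/2} ∫_{ℝ^k} f(x) exp(−i⟨t,x⟩) dx ≠ 0. Let δ : ℝ^k → ℝ be measurable and essentially bounded. If for every τ ∈ ℝ^k, ∫_{ℝ^k} f(u + τ) δ(u) du = 0 (the integrand being integrable since f is integrable and δ is essentially bounded), then δ = 0 Lebesgue-almost everywhere. -/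
open MeasureTheory Complex
open scoped RealInnerProductSpace

namespace WienerTauberian

open ContinuousLinearMap FourierTransform Filter Topology
open scoped Convolution ENNReal SchwartzMap

variable {E : Type*} [NormedAddCommGroup E] [InnerProductSpace ℝ E] [FiniteDimensional ℝ E]

/-- A smooth bump function, as a complex-valued Schwartz function. -/
noncomputable def bumpSchwartz {c : E} (β : ContDiffBump c) : 𝓢(E, ℂ) :=
  HasCompactSupport.toSchwartzMap (f := fun x => (β x : ℂ))
    (β.hasCompactSupport.comp_left ofReal_zero) (ofRealCLM.contDiff.comp β.contDiff)

lemma bumpSchwartz_apply {c : E} (β : ContDiffBump c) (x : E) : bumpSchwartz β x = β x := rfl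

variable [MeasurableSpace E] [BorelSpace E]

section BoundedConvolution

variable {f g k : E → ℂ} {C : ℝ}

lemma convolutionExistsAt_of_bdd (hf : Integrable f) (hk : Measurable k) (hC : ∀ x, ‖k x‖ ≤ C)
    (x : E) : ConvolutionExistsAt f k x (mul ℂ ℂ) :=
  hf.mul_bdd (c := C) (hk.comp (measurable_const.sub measurable_id)).aestronglyMeasurable
    (.of_forall fun _ => hC _)

lemma convolution_assoc_of_bdd (hf : Integrable f) (hg : Integrable g) (hk : Measurable k)
    (hC : ∀ x, ‖k x‖ ≤ C) :
    (f ⋆[mul ℂ ℂ] g) ⋆[mul ℂ ℂ] k = f ⋆[mul ℂ ℂ] (g ⋆[mul ℂ ℂ] k) := by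
  ext x₀
  refine convolution_assoc' (mul ℂ ℂ) (mul ℂ ℂ) (mul ℂ ℂ) (mul ℂ ℂ) (fun x y z => mul_assoc x y z)
    (hf.ae_convolution_exists _ hg)
    (.of_forall fun x => convolutionExistsAt_of_bdd hg hk hC x) ?_
  have h := (hf.convolution_integrand (mul ℂ ℂ) hg).mul_bdd (c := C) (g := fun p => k (x₀ - p.1))
    (hk.comp (measurable_const.sub measurable_fst)).aestronglyMeasurable (.of_forall fun _ => hC _)
  refine h.congr (.of_forall fun p => ?_)
  simp [Function.uncurry, mul_assoc]

lemma convolution_mul_comm (f g : E → ℂ) : f ⋆[mul ℂ ℂ] g = g ⋆[mul ℂ ℂ] f := by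
  rw [← convolution_flip, ContinuousLinearMap.flip_mul]

lemma norm_convolution_le_of_bdd (hf : Integrable f) (hC : ∀ x, ‖k x‖ ≤ C) (x : E) :
    ‖(f ⋆[mul ℂ ℂ] k) x‖ ≤ (∫ y, ‖f y‖) * C := by
  rw [convolution_def, ← integral_mul_const]
  refine norm_integral_le_of_norm_le (hf.norm.mul_const C) (.of_forall fun y => ?_)
  simpa using mul_le_mul_of_nonneg_left (hC (x - y)) (norm_nonneg (f y))

lemma measurable_convolution (hf : Continuous f) (hk : Measurable k) :
    Measurable (f ⋆[mul ℂ ℂ] k) := by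
  have : StronglyMeasurable fun p : E × E => f p.2 * k (p.1 - p.2) :=
    ((hf.measurable.comp measurable_snd).mul
      (hk.comp (measurable_fst.sub measurable_snd))).stronglyMeasurable
  exact this.integral_prod_right.measurable

end BoundedConvolution

section Translation

variable {a b : E → ℂ}

lemma tendsto_lintegral_enorm_translate_sub (hb : Integrable b) :
    Tendsto (fun h : E => ∫⁻ x, ‖b (x - h) - b x‖ₑ) (𝓝 0) (𝓝 0) := by
  have hm : MemLp b 1 volume := memLp_one_iff_integrable.2 hb
  have key : ∀ h : E, ∫⁻ x, ‖b (x - h) - b x‖ₑ =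
      edist (DomAddAct.mk (-h) +ᵥ hm.toLp b) (hm.toLp b) := fun h => by
    rw [DomAddAct.mk_vadd_toLp, Lp.edist_toLp_toLp, eLpNorm_one_eq_lintegral_enorm]
    simp [sub_eq_neg_add]
  simp_rw [key]
  have hc : Continuous fun h : E => edist (DomAddAct.mk (-h) +ᵥ hm.toLp b) (hm.toLp b) := by
    have h1 : Continuous fun h : E => DomAddAct.mk (-h) :=
      DomAddAct.continuous_mk.comp continuous_neg
    have : Fact ((1 : ℝ≥0∞) ≠ ∞) := ⟨ENNReal.one_ne_top⟩
    exact (h1.vadd continuous_const).edist continuous_const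
  have := hc.tendsto 0
  simpa using this

lemma lintegral_enorm_translate_sub_le (hb : Integrable b) (h : E) :
    ∫⁻ x, ‖b (x - h) - b x‖ₑ ≤ 2 * ∫⁻ x, ‖b x‖ₑ := by
  calc _ ≤ ∫⁻ x, (‖b (x - h)‖ₑ + ‖b x‖ₑ) := lintegral_mono fun x => enorm_sub_le
    _ = (∫⁻ x, ‖b (x - h)‖ₑ) + ∫⁻ x, ‖b x‖ₑ := lintegral_add_right' _ hb.aestronglyMeasurable.enorm
    _ = _ := by rw [lintegral_sub_right_eq_self (fun x => ‖b x‖ₑ) h, two_mul]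

lemma tendsto_lintegral_mul_translate (ha : Integrable a) (hb : Integrable b)
    (hbc : Continuous b) :
    Tendsto (fun s : ℝ => ∫⁻ y, ‖a y‖ₑ * ∫⁻ x, ‖b (x - s • y) - b x‖ₑ) (𝓝 0) (𝓝 0) := by
  have h0 : ∫⁻ y : E, ‖a y‖ₑ * 0 = 0 := by simp
  rw [← h0]
  refine tendsto_lintegral_filter_of_dominated_convergence'
    (fun y => ‖a y‖ₑ * (2 * ∫⁻ x, ‖b x‖ₑ)) (.of_forall fun s => ?_)
    (.of_forall fun s => .of_forall fun y => ?_) ?_ (.of_forall fun y => ?_)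
  · refine ha.aestronglyMeasurable.enorm.mul (Measurable.aemeasurable ?_)
    refine Measurable.lintegral_prod_right' (f := fun p : E × E => ‖b (p.2 - s • p.1) - b p.2‖ₑ) ?_
    exact Continuous.measurable (by fun_prop)
  · exact mul_le_mul_right (lintegral_enorm_translate_sub_le hb _) _
  · rw [lintegral_mul_const'' _ ha.aestronglyMeasurable.enorm]
    exact ENNReal.mul_ne_top ha.2.ne (ENNReal.mul_ne_top (by simp) hb.2.ne)
  · refine ENNReal.Tendsto.const_mul ?_ (.inr (by simp))
    refine (tendsto_lintegral_enorm_translate_sub hb).comp ?_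
    exact (continuous_id.smul continuous_const).tendsto' _ _ (by simp)

lemma lintegral_enorm_integral_mul_translate_le (ha : Integrable a) (hbc : Continuous b) (s : ℝ) :
    ∫⁻ x, ‖∫ y, a y * (b (x - s • y) - b x)‖ₑ ≤
      ∫⁻ y, ‖a y‖ₑ * ∫⁻ x, ‖b (x - s • y) - b x‖ₑ := by
  calc _ ≤ ∫⁻ x, ∫⁻ y, ‖a y‖ₑ * ‖b (x - s • y) - b x‖ₑ :=
        lintegral_mono fun x => (enorm_integral_le_lintegral_enorm _).trans_eq (by simp)
    _ = ∫⁻ y, ∫⁻ x, ‖a y‖ₑ * ‖b (x - s • y) - b x‖ₑ := by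
        refine lintegral_lintegral_swap ?_
        refine AEMeasurable.mul ha.aestronglyMeasurable.enorm.comp_snd (Measurable.aemeasurable ?_)
        exact Continuous.measurable (by fun_prop)
    _ = _ := lintegral_congr fun y => lintegral_const_mul _ (Continuous.measurable (by fun_prop))

end Translation

section Dilation

lemma lintegral_comp_smul (F : E → ℝ≥0∞) {r : ℝ} (hr : 0 < r) :
    ENNReal.ofReal (r ^ Module.finrank ℝ E) * ∫⁻ x, F (r • x) = ∫⁻ x, F x := by
  have he := (Homeomorph.smulOfNeZero r hr.ne' (α := E)).measurableEmbedding
  have h1 : ∫⁻ x, F (r • x) = ∫⁻ x, F x ∂(Measure.map (r • ·) volume) :=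
    (he.lintegral_map _).symm
  rw [h1, Measure.map_addHaar_smul _ hr.ne', lintegral_smul_measure, smul_eq_mul, ← mul_assoc,
    ← ENNReal.ofReal_mul (by positivity), abs_of_pos (by positivity),
    mul_inv_cancel₀ (by positivity)]
  simp

lemma fourierInv_dilate {χ X : E → ℂ} {t₀ : E} {ε : ℝ} (hε : 0 < ε)
    (h : ∀ t, X t = χ (ε⁻¹ • (t - t₀))) (x : E) :
    𝓕⁻ X x = Real.fourierChar ⟪t₀, x⟫ * (ε ^ Module.finrank ℝ E * 𝓕⁻ χ (ε • x)) := by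
  rw [Real.fourierInv_eq, Real.fourierInv_eq, ← integral_add_right_eq_self _ t₀]
  set G : E → ℂ := fun u => Real.fourierChar ⟪t₀, x⟫ * (Real.fourierChar ⟪u, ε • x⟫ • χ u) with hG
  have h1 : ∀ v : E, Real.fourierChar ⟪v + t₀, x⟫ • X (v + t₀) = G (ε⁻¹ • v) := fun v => by
    simp only [hG, h, add_sub_cancel_right, inner_add_left, AddChar.map_add_eq_mul, Circle.smul_def,
      smul_eq_mul, Circle.coe_mul, inner_smul_left, inner_smul_right, RCLike.conj_to_real]
    rw [mul_inv_cancel_left₀ hε.ne']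
    ring
  rw [integral_congr_ae (.of_forall h1), Measure.integral_comp_inv_smul_of_nonneg _ G hε.le, hG,
    integral_const_mul, real_smul]
  push_cast
  ring

lemma lintegral_convolution_sub_le {f ψ : E → ℂ} (hf : Integrable f) (b : 𝓢(E, ℂ)) {t₀ : E}
    {ε : ℝ} (hε : 0 < ε)
    (hψ : ∀ x, ψ x = Real.fourierChar ⟪t₀, x⟫ * (ε ^ Module.finrank ℝ E * b (ε • x))) :
    ∫⁻ x, ‖(f ⋆[mul ℂ ℂ] ψ) x - 𝓕 f t₀ * ψ x‖ₑ ≤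
      ∫⁻ y, ‖f y‖ₑ * ∫⁻ x, ‖b (x - ε • y) - b x‖ₑ := by
  set a : E → ℂ := fun y => Real.fourierChar (-⟪y, t₀⟫) • f y with ha_def
  have ha : Integrable a := (Real.fourierIntegral_convergent_iff t₀).2 hf
  have hbd : ∀ x, ‖b x‖ ≤ SchwartzMap.seminorm ℝ 0 0 b := b.norm_le_seminorm ℝ
  have key : ∀ x, (f ⋆[mul ℂ ℂ] ψ) x - 𝓕 f t₀ * ψ x =
      Real.fourierChar ⟪t₀, x⟫ * (ε ^ Module.finrank ℝ E *
        ∫ y, a y * (b (ε • x - ε • y) - b (ε • x))) := fun x => by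
    have h1 : Integrable fun y => a y * b (ε • x - ε • y) :=
      ha.mul_bdd (by fun_prop) (.of_forall fun _ => hbd _)
    simp_rw [mul_sub]
    rw [integral_sub h1 (ha.mul_const _), integral_mul_const, Real.fourier_eq, mul_sub, mul_sub,
      hψ x, convolution_def, ← integral_const_mul, ← integral_const_mul]
    congr 1
    · refine integral_congr_ae (.of_forall fun y => ?_)
      simp only [mul_apply', hψ, ha_def, Circle.smul_def, smul_eq_mul, inner_sub_right, smul_sub,
        sub_eq_add_neg ⟪t₀, x⟫, AddChar.map_add_eq_mul, Circle.coe_mul, real_inner_comm t₀ y]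
      ring
    · ring
  set H : E → ℝ≥0∞ := fun z => ‖∫ y, a y * (b (z - ε • y) - b z)‖ₑ
  have henorm : ∀ x, ‖(f ⋆[mul ℂ ℂ] ψ) x - 𝓕 f t₀ * ψ x‖ₑ =
      ENNReal.ofReal (ε ^ Module.finrank ℝ E) * H (ε • x) := fun x => by
    rw [key, ← ofReal_norm, norm_mul, Circle.norm_coe, one_mul, norm_mul, norm_pow, norm_real,
      Real.norm_of_nonneg hε.le, ENNReal.ofReal_mul (by positivity), ofReal_norm]
  rw [lintegral_congr henorm, lintegral_const_mul' _ _ ENNReal.ofReal_ne_top,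
    lintegral_comp_smul H hε]
  refine (lintegral_enorm_integral_mul_translate_le ha b.continuous ε).trans_eq ?_
  refine lintegral_congr fun y => ?_
  rw [ha_def, ← ofReal_norm, Circle.norm_smul, ofReal_norm]

lemma lintegral_dilate_convolution_sub_le {ψ : E → ℂ} (b g : 𝓢(E, ℂ)) {ε : ℝ} (hε : 0 < ε)
    (hψ : ∀ x, ψ x = ε ^ Module.finrank ℝ E * b (ε • x)) (hb : ∫ x, b x = 1) :
    ∫⁻ x, ‖(ψ ⋆[mul ℂ ℂ] g) x - g x‖ₑ ≤
      ∫⁻ y, ‖b y‖ₑ * ∫⁻ x, ‖g (x - ε⁻¹ • y) - g x‖ₑ := by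
  have hbd : ∀ x, ‖g x‖ ≤ SchwartzMap.seminorm ℝ 0 0 g := g.norm_le_seminorm ℝ
  have key : ∀ x, (ψ ⋆[mul ℂ ℂ] g) x - g x = ∫ y, b y * (g (x - ε⁻¹ • y) - g x) := fun x => by
    have h1 : Integrable fun y => b y * g (x - ε⁻¹ • y) :=
      b.integrable.mul_bdd (by fun_prop) (.of_forall fun _ => hbd _)
    simp_rw [mul_sub]
    rw [integral_sub h1 (b.integrable.mul_const _), integral_mul_const, hb, one_mul,
      convolution_def]
    congr 1
    have h2 := Measure.integral_comp_smul_of_nonneg volume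
      (fun y : E => b y * g (x - ε⁻¹ • y)) ε (hR := hε.le)
    have h3 : ∀ y, mul ℂ ℂ (ψ y) (g (x - y)) =
        (ε ^ Module.finrank ℝ E : ℝ) • (b (ε • y) * g (x - ε⁻¹ • ε • y)) := fun y => by
      rw [inv_smul_smul₀ hε.ne', mul_apply', hψ, real_smul]
      push_cast
      ring
    simp_rw [h3]
    rw [integral_smul, h2, smul_smul, mul_inv_cancel₀ (by positivity), one_smul]
  simp_rw [key]
  exact lintegral_enorm_integral_mul_translate_le b.integrable g.continuous _

end Dilation

lemma eq_zero_of_convolution_eq_self {r G : E → ℂ} (hr : Integrable r) (hr1 : ∫ x, ‖r x‖ < 1)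
    {C : ℝ} (hG : ∀ x, ‖G x‖ ≤ C) (h : r ⋆[mul ℂ ℂ] G = G) : G = 0 := by
  have hbdd : BddAbove (Set.range fun x => ‖G x‖) := ⟨C, by rintro _ ⟨x, rfl⟩; exact hG x⟩
  set M := ⨆ x, ‖G x‖ with hM
  have hle : ∀ x, ‖G x‖ ≤ M := le_ciSup hbdd
  have hM1 : M ≤ (∫ x, ‖r x‖) * M := ciSup_le fun x => by
    conv_lhs => rw [← h]
    exact norm_convolution_le_of_bdd hr hle x
  have hM0 : M ≤ 0 := by nlinarith
  ext x
  simpa using (hle x).trans hM0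

section Spectrum

lemma fourierInv_pairing (φ X : 𝓢(E, ℂ)) :
    ((𝓕⁻ X : 𝓢(E, ℂ)) : E → ℂ) ⋆[mul ℂ ℂ] (𝓕⁻ φ : 𝓢(E, ℂ)) =
      (𝓕⁻ (SchwartzMap.pairing (mul ℂ ℂ) X φ) : 𝓢(E, ℂ)) := by
  ext x
  rw [← SchwartzMap.convolution_apply]
  congr 1
  simp [SchwartzMap.convolution]

/-- The bump function that equals `1` on the ball of radius `ε` about `t₀` and is supported in the
ball of radius `2 * ε`. -/
noncomputable def dilatedBump (t₀ : E) {ε : ℝ} (hε : 0 < ε) : ContDiffBump t₀ :=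
  ⟨ε, 2 * ε, hε, by linarith⟩

lemma fourierInv_dilatedBump (t₀ : E) {ε : ℝ} (hε : 0 < ε) (x : E) :
    (𝓕⁻ (bumpSchwartz (dilatedBump t₀ hε)) : 𝓢(E, ℂ)) x = Real.fourierChar ⟪t₀, x⟫ *
      (ε ^ Module.finrank ℝ E *
        (𝓕⁻ (bumpSchwartz (dilatedBump (0 : E) one_pos)) : 𝓢(E, ℂ)) (ε • x)) := by
  rw [SchwartzMap.fourierInv_coe, SchwartzMap.fourierInv_coe]
  refine fourierInv_dilate hε (fun t => ?_) x
  simp [bumpSchwartz_apply, dilatedBump, ContDiffBump.apply, hε.ne']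

variable {f D : E → ℂ} {C : ℝ}

/-- Near a point where `𝓕 f` does not vanish, the spectrum of a bounded `D` with `f ⋆ D = 0` is
empty: Schwartz functions with frequencies cut off near that point annihilate `D`. -/
lemma exists_cutoff_convolution_eq_zero (hf : Integrable f) (hD : Measurable D)
    (hC : ∀ x, ‖D x‖ ≤ C) (h : f ⋆[mul ℂ ℂ] D = 0) {t₀ : E} (ht₀ : 𝓕 f t₀ ≠ 0) :
    ∃ U ∈ 𝓝 t₀, ∃ θ : E → ℂ, θ.HasTemperateGrowth ∧ (∀ t ∈ U, θ t = 1) ∧ ∀ φ : 𝓢(E, ℂ),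
      ((𝓕⁻ (SchwartzMap.smulLeftCLM ℂ θ φ) : 𝓢(E, ℂ)) : E → ℂ) ⋆[mul ℂ ℂ] D = 0 := by
  set c := 𝓕 f t₀
  set b : 𝓢(E, ℂ) := 𝓕⁻ (bumpSchwartz (dilatedBump (0 : E) one_pos)) with hb
  obtain ⟨ε, hε_lt, hε⟩ : ∃ ε : ℝ,
      ∫⁻ y, ‖f y‖ₑ * ∫⁻ x, ‖b (x - ε • y) - b x‖ₑ < ‖c‖ₑ ∧ 0 < ε :=
    ((((tendsto_lintegral_mul_translate hf b.integrable b.continuous).mono_left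
      nhdsWithin_le_nhds).eventually_lt_const (by simpa using ht₀)).and
        (self_mem_nhdsWithin (s := Set.Ioi (0 : ℝ)))).exists
  set X := bumpSchwartz (dilatedBump t₀ hε)
  set ψ : 𝓢(E, ℂ) := 𝓕⁻ X with hψ
  have hfψ : Integrable (f ⋆[mul ℂ ℂ] ψ) := hf.integrable_convolution _ ψ.integrable
  set r : E → ℂ := (ψ : E → ℂ) - c⁻¹ • (f ⋆[mul ℂ ℂ] ψ) with hr_def
  have hr : Integrable r := ψ.integrable.sub (hfψ.smul _)
  have hr1 : ∫ x, ‖r x‖ < 1 := by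
    have h1 : ∀ x, ‖r x‖ₑ = ‖c‖ₑ⁻¹ * ‖(f ⋆[mul ℂ ℂ] ψ) x - c * ψ x‖ₑ := fun x => by
      rw [← enorm_inv ht₀, ← enorm_mul, ← enorm_neg]
      congr 1
      simp only [hr_def, Pi.sub_apply, Pi.smul_apply, smul_eq_mul]
      field_simp
      ring
    have hc0 : ‖c‖ₑ ≠ 0 := by simpa using ht₀
    have h2 : ∫⁻ x, ‖r x‖ₑ < 1 := by
      rw [lintegral_congr h1, lintegral_const_mul' _ _ (by simpa using hc0), mul_comm,
        ← div_eq_mul_inv]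
      refine ENNReal.div_lt_of_lt_mul' ?_
      rw [mul_one]
      exact (lintegral_convolution_sub_le hf b hε (fourierInv_dilatedBump t₀ hε)).trans_lt hε_lt
    rw [integral_norm_eq_lintegral_enorm hr.aestronglyMeasurable]
    simpa using (ENNReal.toReal_lt_toReal h2.ne_top ENNReal.one_ne_top).2 h2
  let β : ContDiffBump t₀ := ⟨ε / 2, ε, by positivity, by linarith⟩
  have hθ : (bumpSchwartz β : E → ℂ).HasTemperateGrowth := (bumpSchwartz β).hasTemperateGrowth
  refine ⟨Metric.closedBall t₀ (ε / 2), Metric.closedBall_mem_nhds _ (by positivity),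
    bumpSchwartz β, hθ, fun t ht => by
      rw [bumpSchwartz_apply, β.one_of_mem_closedBall ht, ofReal_one], fun φ => ?_⟩
  set Φ := SchwartzMap.smulLeftCLM ℂ (bumpSchwartz β) φ with hΦ
  have hXΦ : SchwartzMap.pairing (mul ℂ ℂ) X Φ = Φ := by
    ext t
    rw [SchwartzMap.pairing_apply_apply, hΦ, SchwartzMap.smulLeftCLM_apply_apply hθ, mul_apply',
      smul_eq_mul, ← mul_assoc]
    congr 1
    by_cases ht : t ∈ Metric.closedBall t₀ ε
    · rw [bumpSchwartz_apply, (dilatedBump t₀ hε).one_of_mem_closedBall ht, ofReal_one, one_mul]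
    · rw [bumpSchwartz_apply β, β.zero_of_le_dist (not_le.1 ht).le]
      simp
  set φ' : 𝓢(E, ℂ) := 𝓕⁻ Φ
  have hψφ : (ψ : E → ℂ) ⋆[mul ℂ ℂ] φ' = φ' := by rw [fourierInv_pairing, hXΦ]
  set G : E → ℂ := φ' ⋆[mul ℂ ℂ] D
  have hG : Measurable G := measurable_convolution φ'.continuous hD
  have hGC : ∀ x, ‖G x‖ ≤ (∫ y, ‖φ' y‖) * C := norm_convolution_le_of_bdd φ'.integrable hC
  have hψG : (ψ : E → ℂ) ⋆[mul ℂ ℂ] G = G := by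
    rw [← convolution_assoc_of_bdd ψ.integrable φ'.integrable hD hC, hψφ]
  have hfG : f ⋆[mul ℂ ℂ] G = 0 := by
    rw [← convolution_assoc_of_bdd hf φ'.integrable hD hC, convolution_mul_comm f,
      convolution_assoc_of_bdd φ'.integrable hf hD hC, h, convolution_zero]
  refine eq_zero_of_convolution_eq_self hr hr1 hGC ?_
  have hfψG : (f ⋆[mul ℂ ℂ] ψ) ⋆[mul ℂ ℂ] G = 0 := by
    rw [convolution_assoc_of_bdd hf ψ.integrable hG hGC, hψG, hfG]
  ext x
  have h1 := (convolutionExistsAt_of_bdd ψ.integrable hG hGC x).add_distrib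
    (convolutionExistsAt_of_bdd (hfψ.smul (-c⁻¹)) hG hGC x)
  rw [hr_def, sub_eq_add_neg, ← neg_smul, h1, smul_convolution, hfψG, hψG]
  simp

lemma convolution_fourierInv_eq_zero (hf : Integrable f) (hf0 : ∀ t, 𝓕 f t ≠ 0)
    (hD : Measurable D) (hC : ∀ x, ‖D x‖ ≤ C) (h : f ⋆[mul ℂ ℂ] D = 0) {φ : 𝓢(E, ℂ)}
    (hφ : HasCompactSupport φ) :
    ((𝓕⁻ φ : 𝓢(E, ℂ)) : E → ℂ) ⋆[mul ℂ ℂ] D = 0 := by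
  let T : 𝓢(E, ℂ) → E → ℂ := fun φ => ((𝓕⁻ φ : 𝓢(E, ℂ)) : E → ℂ) ⋆[mul ℂ ℂ] D
  have hT : ∀ φ₁ φ₂, T (φ₁ + φ₂) = T φ₁ + T φ₂ := fun φ₁ φ₂ => by
    ext x
    simp only [T, FourierTransform.fourierInv_add]
    exact (convolutionExistsAt_of_bdd (SchwartzMap.integrable _) hD hC x).add_distrib
      (convolutionExistsAt_of_bdd (SchwartzMap.integrable _) hD hC x)
  obtain ⟨θ, hθ, hθ1, hθT⟩ : ∃ θ : E → ℂ, θ.HasTemperateGrowth ∧ (∀ t ∈ tsupport φ, θ t = 1) ∧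
      ∀ φ : 𝓢(E, ℂ), T (SchwartzMap.smulLeftCLM ℂ θ φ) = 0 := by
    refine hφ.isCompact.induction_on (p := fun s => ∃ θ : E → ℂ, θ.HasTemperateGrowth ∧
      (∀ t ∈ s, θ t = 1) ∧ ∀ φ : 𝓢(E, ℂ), T (SchwartzMap.smulLeftCLM ℂ θ φ) = 0) ?_ ?_ ?_ ?_
    · refine ⟨fun _ => 0, .const 0, by simp, fun φ => ?_⟩
      have := hT 0 0
      simp only [SchwartzMap.smulLeftCLM_const]
      simpa using this
    · rintro s t hst ⟨θ, hθ, hθ1, hθT⟩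
      exact ⟨θ, hθ, fun x hx => hθ1 x (hst hx), hθT⟩
    · rintro s t ⟨θ, hθ, hθ1, hθT⟩ ⟨η, hη, hη1, hηT⟩
      have hη' : (fun x => 1 - η x).HasTemperateGrowth :=
        (Function.HasTemperateGrowth.const 1).sub hη
      have hsum : (fun x => η x + θ x * (1 - η x)).HasTemperateGrowth := hη.add (hθ.mul hη')
      refine ⟨fun x => η x + θ x * (1 - η x), hsum, ?_, fun φ => ?_⟩
      · rintro x (hx | hx)
        · simp [hθ1 x hx]
        · simp [hη1 x hx]
      · have h1 : SchwartzMap.smulLeftCLM ℂ (fun x => η x + θ x * (1 - η x)) φ =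
            SchwartzMap.smulLeftCLM ℂ η φ +
              SchwartzMap.smulLeftCLM ℂ θ (SchwartzMap.smulLeftCLM ℂ (fun x => 1 - η x) φ) := by
          ext x
          simp only [add_apply, SchwartzMap.smulLeftCLM_apply_apply hη,
            SchwartzMap.smulLeftCLM_apply_apply hθ, SchwartzMap.smulLeftCLM_apply_apply hη',
            SchwartzMap.smulLeftCLM_apply_apply hsum, smul_eq_mul]
          ring
        rw [h1, hT, hηT, hθT, add_zero]
    · intro t _
      obtain ⟨U, hU, θ, hθ⟩ := exists_cutoff_convolution_eq_zero hf hD hC h (hf0 t)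
      exact ⟨U, mem_nhdsWithin_of_mem_nhds hU, θ, hθ⟩
  have hθφ : SchwartzMap.smulLeftCLM ℂ θ φ = φ := by
    ext x
    rw [SchwartzMap.smulLeftCLM_apply_apply hθ]
    by_cases hx : x ∈ tsupport φ
    · rw [hθ1 x hx, one_smul]
    · rw [image_eq_zero_of_notMem_tsupport hx, smul_zero]
  rw [← hθφ]
  exact hθT φ

lemma convolution_schwartz_eq_zero (hf : Integrable f) (hf0 : ∀ t, 𝓕 f t ≠ 0)
    (hD : Measurable D) (hC : ∀ x, ‖D x‖ ≤ C) (h : f ⋆[mul ℂ ℂ] D = 0) (g : 𝓢(E, ℂ)) :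
    (g : E → ℂ) ⋆[mul ℂ ℂ] D = 0 := by
  have hC0 : 0 ≤ C := (norm_nonneg _).trans (hC 0)
  set b : 𝓢(E, ℂ) := 𝓕⁻ (bumpSchwartz (dilatedBump (0 : E) one_pos)) with hb
  have hb1 : ∫ x, b x = 1 := by
    have h1 : (𝓕 b : 𝓢(E, ℂ)) 0 = 1 := by
      rw [hb, FourierTransform.fourier_fourierInv_eq, bumpSchwartz_apply,
        ContDiffBump.one_of_mem_closedBall _ (by simp [dilatedBump]), ofReal_one]
    rw [SchwartzMap.fourier_coe, Real.fourier_eq] at h1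
    simpa using h1
  ext x
  have key : ∀ η : ℝ, 0 < η → ‖((g : E → ℂ) ⋆[mul ℂ ℂ] D) x‖ ≤ η * C := fun η hη => by
    obtain ⟨s, hs_lt, hs⟩ : ∃ s : ℝ,
        ∫⁻ y, ‖b y‖ₑ * ∫⁻ x, ‖g (x - s • y) - g x‖ₑ < ENNReal.ofReal η ∧ 0 < s :=
      ((((tendsto_lintegral_mul_translate b.integrable g.integrable g.continuous).mono_left
        nhdsWithin_le_nhds).eventually_lt_const (by simpa using hη)).and
          (self_mem_nhdsWithin (s := Set.Ioi (0 : ℝ)))).exists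
    have hs' : 0 < s⁻¹ := inv_pos.2 hs
    set X := bumpSchwartz (dilatedBump (0 : E) hs')
    set ψ : 𝓢(E, ℂ) := 𝓕⁻ X with hψ
    have hψg : (ψ : E → ℂ) ⋆[mul ℂ ℂ] g =
        (𝓕⁻ (SchwartzMap.pairing (mul ℂ ℂ) X (𝓕 g)) : 𝓢(E, ℂ)) := by
      rw [← fourierInv_pairing, FourierTransform.fourierInv_fourier_eq]
    have hcs : HasCompactSupport (SchwartzMap.pairing (mul ℂ ℂ) X (𝓕 g)) := by
      have hX : HasCompactSupport X :=
        (dilatedBump (0 : E) hs').hasCompactSupport.comp_left ofReal_zero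
      refine hX.mono fun t ht hXt => ht ?_
      simp [SchwartzMap.pairing_apply_apply, hXt]
    have h0 := convolution_fourierInv_eq_zero hf hf0 hD hC h hcs
    rw [← hψg] at h0
    have hi : Integrable ((ψ : E → ℂ) ⋆[mul ℂ ℂ] g) :=
      ψ.integrable.integrable_convolution _ g.integrable
    have hlt : ∫⁻ x, ‖((ψ : E → ℂ) ⋆[mul ℂ ℂ] g) x - g x‖ₑ < ENNReal.ofReal η := by
      refine (lintegral_dilate_convolution_sub_le b g hs' (fun x => ?_) hb1).trans_lt
        (by simpa using hs_lt)
      rw [hψ, fourierInv_dilatedBump]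
      simp [hb]
    have hle : ∫ x, ‖(((ψ : E → ℂ) ⋆[mul ℂ ℂ] g) - g) x‖ ≤ η := by
      rw [integral_norm_eq_lintegral_enorm (hi.sub g.integrable).aestronglyMeasurable]
      exact ENNReal.toReal_le_of_le_ofReal hη.le hlt.le
    have h1 := (convolutionExistsAt_of_bdd (hi.sub g.integrable) hD hC x).add_distrib
      (convolutionExistsAt_of_bdd g.integrable hD hC x)
    rw [sub_add_cancel, h0, Pi.zero_apply] at h1
    rw [eq_neg_of_add_eq_zero_right h1.symm, norm_neg]
    exact (norm_convolution_le_of_bdd (hi.sub g.integrable) hC x).trans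
      (mul_le_mul_of_nonneg_right hle hC0)
  have hlim : Tendsto (fun η : ℝ => η * C) (𝓝[>] 0) (𝓝 0) :=
    ((continuous_id.mul continuous_const).tendsto' 0 0 (by simp)).mono_left nhdsWithin_le_nhds
  have := ge_of_tendsto hlim (eventually_nhdsWithin_of_forall key)
  simpa using this

end Spectrum

end WienerTauberian

/-- **Steps E.4–E.5: Wiener Tauberian completeness.** If `f : ℝ^k → ℝ` (`k ≥ 1`) is
Lebesgue integrable with nowhere-vanishing Fourier transform, and `δ` is measurable and
essentially bounded with `∫ f (u + τ) δ(u) du = 0` for every translation `τ ∈ ℝ^k`, then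
`δ = 0` Lebesgue-almost everywhere. -/
theorem wiener_tauberian_orthogonal_translates
    (k : ℕ) (hk : 1 ≤ k)
    (f : EuclideanSpace ℝ (Fin k) → ℝ)
    (hf_int : Integrable f volume)
    (hf_fourier : ∀ t : EuclideanSpace ℝ (Fin k),
      ((2 * Real.pi) ^ (-(k : ℝ) / 2) : ℝ) •
        ∫ x, (f x : ℂ) * Complex.exp (-Complex.I * (⟪t, x⟫ : ℝ)) ≠ 0)
    (δ : EuclideanSpace ℝ (Fin k) → ℝ)
    (hδ_meas : Measurable δ)
    (hδ_bdd : ∃ C : ℝ, ∀ᵐ u : EuclideanSpace ℝ (Fin k), |δ u| ≤ C)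
    (h0 : ∀ τ : EuclideanSpace ℝ (Fin k),
      ∫ u : EuclideanSpace ℝ (Fin k), f (u + τ) * δ u = 0) :
    δ =ᵐ[volume] 0 := by
  open ContinuousLinearMap FourierTransform Filter Topology Convolution SchwartzMap ContDiff in
  obtain ⟨C, hC⟩ := hδ_bdd
  set S : Set (EuclideanSpace ℝ (Fin k)) := {u | |δ u| ≤ C}
  have hS : MeasurableSet S := measurableSet_le (by fun_prop) measurable_const
  set δ' : EuclideanSpace ℝ (Fin k) → ℝ := S.indicator δ with hδ'_def
  have hδ' : Measurable δ' := hδ_meas.indicator hS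
  have hδδ' : δ =ᵐ[volume] δ' := by
    filter_upwards [hC] with u hu
    rw [hδ'_def, Set.indicator_of_mem (show u ∈ S from hu)]
  have hbd : ∀ u, |δ' u| ≤ |C| := fun u => by
    by_cases hu : u ∈ S
    · rw [hδ'_def, Set.indicator_of_mem hu]
      exact (show |δ u| ≤ C from hu).trans (le_abs_self C)
    · rw [hδ'_def, Set.indicator_of_notMem hu]
      simp
  set F : EuclideanSpace ℝ (Fin k) → ℂ := fun x => f x with hF
  set D : EuclideanSpace ℝ (Fin k) → ℂ := fun u => δ' (-u) with hD_def
  have hD : Measurable D := measurable_ofReal.comp (hδ'.comp measurable_neg)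
  have hDC : ∀ u, ‖D u‖ ≤ |C| := fun u => by simpa [hD_def] using hbd (-u)
  have hFD : F ⋆[mul ℂ ℂ] D = 0 := by
    ext τ
    rw [convolution_def, ← integral_add_right_eq_self _ τ]
    have h1 : ∀ u, mul ℂ ℂ (F (u + τ)) (D (τ - (u + τ))) = ((f (u + τ) * δ' u : ℝ) : ℂ) :=
      fun u => by simp [hF, hD_def]
    rw [integral_congr_ae (.of_forall h1), integral_complex_ofReal, Pi.zero_apply, ofReal_eq_zero,
      ← h0 τ]
    refine integral_congr_ae ?_
    filter_upwards [hδδ'] with u hu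
    rw [hu]
  have hF0 : ∀ t, 𝓕 F t ≠ 0 := fun t => by
    have h1 := right_ne_zero_of_smul (hf_fourier ((2 * Real.pi) • t))
    rw [Real.fourier_eq']
    convert! h1 using 3 with x
    rw [smul_eq_mul, mul_comm, inner_smul_left, real_inner_comm]
    congr 2
    simp
    ring
  have hloc : LocallyIntegrable δ' volume := by
    refine (memLp_top_of_bound hδ'.aestronglyMeasurable |C| (.of_forall hbd)).locallyIntegrable
      le_top
  refine hδδ'.trans (ae_eq_zero_of_integral_contDiff_smul_eq_zero hloc fun g hg hgc => ?_)
  let g' : 𝓢(EuclideanSpace ℝ (Fin k), ℂ) :=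
    HasCompactSupport.toSchwartzMap (f := fun x => (g x : ℂ))
      (hgc.comp_left ofReal_zero) (ofRealCLM.contDiff.comp hg)
  have hg' : ∀ u, g' u = (g u : ℂ) := fun _ => rfl
  have h1 := congrFun
    (WienerTauberian.convolution_schwartz_eq_zero hf_int.ofReal hF0 hD hDC hFD g') 0
  rw [convolution_def] at h1
  have h2 : ∀ u, mul ℂ ℂ (g' u) (D (0 - u)) = ((g u • δ' u : ℝ) : ℂ) := fun u => by
    simp [hD_def, hg']
  rw [integral_congr_ae (.of_forall h2), integral_complex_ofReal, Pi.zero_apply,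
    ofReal_eq_zero] at h1
  exact h1
end
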